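/- arXiv:1008.0312 — 2 statements merged into one kernel-verified Lean document; each statement's English description precedes it below -/
import Mathlib

section
/- Let λ, α, β be real numbers, let n ≥ 2 be an integer, and let A = [[1, 0], [−2i·e^{iα/2}·λ·sin(α/2), e^{iα}]] and B = [[e^{iβ}, −2i·e^{iβ/2}·λ·sin(β/2)], [0, 1]]. If U_{n−1}(Λ) = 0, where Λ = (1−λ²)·cos((α−β)/2) + λ²·cos((α+β)/2) and U_{n−1} is the Chebyshev polynomial of the second kind of degree n−1, then (A·B)ⁿ = (B·A)ⁿ. -/
open Complex Matrix

/-- Powers of an element with characteristic equation `M² = 2dx M - d²`, in terms of Chebyshev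
polynomials of the second kind. -/
theorem pow_succ_eq_chebyshev_U {R S : Type*} [CommRing R] [Ring S] [Algebra R S]
    {M : S} {d x : R} (h : M * M = (2 * d * x) • M - (d ^ 2) • (1 : S)) (n : ℕ) :
    M ^ (n + 1) = (d ^ n * (Polynomial.Chebyshev.U R n).eval x) • M
      - (d ^ (n + 1) * (Polynomial.Chebyshev.U R ((n : ℤ) - 1)).eval x) • (1 : S) := by
  induction n with
  | zero => simp
  | succ n ih =>
    have hU := congrArg (Polynomial.eval x) (Polynomial.Chebyshev.U_add_one R n)
    simp only [Polynomial.eval_sub, Polynomial.eval_mul, Polynomial.eval_X,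
      Polynomial.eval_ofNat] at hU
    rw [pow_succ, ih, sub_mul, smul_mul_assoc, h, smul_mul_assoc, one_mul]
    push_cast
    rw [add_sub_cancel_right, hU]
    module

theorem Matrix.mul_self_eq_of_trace_of_det {R : Type*} [CommRing R]
    {M : Matrix (Fin 2) (Fin 2) R} {t d : R} (ht : M.trace = t) (hd : M.det = d) :
    M * M = t • M - d • (1 : Matrix (Fin 2) (Fin 2) R) := by
  subst ht hd
  ext i j
  fin_cases i <;> fin_cases j <;>
    simp [Matrix.mul_apply, Fin.sum_univ_two, Matrix.trace_fin_two, Matrix.det_fin_two] <;> ring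

/-- From the proof of Theorem 2 of the paper: if
`Λ = (1−λ²)·cos((α−β)/2) + λ²·cos((α+β)/2)` is a root of the Chebyshev polynomial
of the second kind `U_{n−1}`, then the holonomy relation `(AB)ⁿ = (BA)ⁿ` of the
torus link group `t(2n, 2)` is satisfied. -/
theorem stmt_12 (lam α β : ℝ) (n : ℕ) (hn : 2 ≤ n)
    (A B : Matrix (Fin 2) (Fin 2) ℂ)
    (hA : A = !![1, 0;
                 -2 * I * Complex.exp (I * α / 2) * lam * Real.sin (α / 2), Complex.exp (I * α)])
    (hB : B = !![Complex.exp (I * β),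
                 -2 * I * Complex.exp (I * β / 2) * lam * Real.sin (β / 2);
                 0, 1])
    (hU : (Polynomial.Chebyshev.U ℝ ((n : ℤ) - 1)).eval
            ((1 - lam ^ 2) * Real.cos ((α - β) / 2) + lam ^ 2 * Real.cos ((α + β) / 2)) = 0) :
    (A * B) ^ n = (B * A) ^ n := by
  obtain ⟨m, rfl⟩ : ∃ m, n = m + 1 := ⟨n - 1, by omega⟩
  set Λ : ℝ := (1 - lam ^ 2) * Real.cos ((α - β) / 2) + lam ^ 2 * Real.cos ((α + β) / 2) with hΛ
  have hU' : (Polynomial.Chebyshev.U ℂ m).eval (Λ : ℂ) = 0 := by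
    rw [← Polynomial.Chebyshev.complex_ofReal_eval_U]
    exact_mod_cast (by simpa using hU)
  have half (x : ℝ) : Complex.exp (I * x) = Complex.exp (I * x / 2) ^ 2 := by
    rw [← Complex.exp_nat_mul]
    congr 1
    push_cast
    ring
  have split (x : ℝ) : Complex.exp (I * x / 2) = Real.cos (x / 2) + Real.sin (x / 2) * I := by
    rw [Complex.ofReal_cos, Complex.ofReal_sin, ← Complex.exp_mul_I]
    congr 1
    push_cast
    ring
  have pyth (x : ℝ) : (Real.sin (x / 2) : ℂ) ^ 2 + (Real.cos (x / 2) : ℂ) ^ 2 = 1 := by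
    exact_mod_cast Real.sin_sq_add_cos_sq (x / 2)
  have hdet : (A * B).det = (Complex.exp (I * α / 2) * Complex.exp (I * β / 2)) ^ 2 := by
    rw [Matrix.det_mul, hA, hB, Matrix.det_fin_two_of, Matrix.det_fin_two_of, half, half]
    ring
  have htr : (A * B).trace
      = 2 * (Complex.exp (I * α / 2) * Complex.exp (I * β / 2)) * (Λ : ℂ) := by
    have hcos : (Λ : ℂ) = Real.cos (α / 2) * Real.cos (β / 2)
        + (1 - 2 * lam ^ 2) * (Real.sin (α / 2) * Real.sin (β / 2)) := by
      rw [hΛ, sub_div, add_div, Real.cos_sub, Real.cos_add]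
      push_cast
      ring
    rw [hcos, hA, hB, half, half]
    simp only [Matrix.trace_fin_two, Matrix.mul_apply, Fin.sum_univ_two, Matrix.of_apply,
      Matrix.cons_val', Matrix.cons_val_zero, Matrix.cons_val_one, Matrix.cons_val_fin_one]
    have ha := pyth α
    have hb := pyth β
    rw [split, split]
    generalize (Real.cos (α / 2) : ℂ) = c at *
    generalize (Real.sin (α / 2) : ℂ) = s at *
    generalize (Real.cos (β / 2) : ℂ) = c' at *
    generalize (Real.sin (β / 2) : ℂ) = s' at *
    have hI := Complex.I_sq
    grind
  rw [pow_succ_eq_chebyshev_U (Matrix.mul_self_eq_of_trace_of_det htr hdet),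
    pow_succ_eq_chebyshev_U (Matrix.mul_self_eq_of_trace_of_det
      ((Matrix.trace_mul_comm B A).trans htr) ((Matrix.det_mul_comm B A).trans hdet)), hU']
  simp
end

section
/- Let λ, α, β be real numbers, let n ≥ 2 and k be integers with 1 ≤ k ≤ n−1, and let A = [[1, 0], [−2i·e^{iα/2}·λ·sin(α/2), e^{iα}]] and B = [[e^{iβ}, −2i·e^{iβ/2}·λ·sin(β/2)], [0, 1]]. If (1−λ²)·cos((α−β)/2) + λ²·cos((α+β)/2) = cos(kπ/n), then (A·B)ⁿ = (−1)^k · e^{in(α+β)/2} · I, where I is the 2×2 identity matrix. -/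
open Complex Matrix

/-- Powers of an element annihilated by `X² - 2c·cos θ·X + c²`, in terms of sines. -/
lemma sin_smul_pow_succ {R : Type*} [Ring R] [Algebra ℂ R] (M : R) (c θ : ℂ)
    (hM : M * M = (2 * c * Complex.cos θ) • M - (c ^ 2) • (1 : R)) (m : ℕ) :
    Complex.sin θ • M ^ (m + 1) =
      (c ^ m * Complex.sin ((m + 1) * θ)) • M - (c ^ (m + 1) * Complex.sin (m * θ)) • (1 : R) := by
  induction m with
  | zero => simp
  | succ m ih =>
    have h : Complex.sin ((m + 1 + 1) * θ) + Complex.sin (m * θ) =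
        2 * Complex.cos θ * Complex.sin ((m + 1) * θ) := by
      rw [show ((m : ℂ) + 1 + 1) * θ = (m + 1) * θ + θ by ring,
        show (m : ℂ) * θ = (m + 1) * θ - θ by ring, Complex.sin_add, Complex.sin_sub]
      ring
    rw [pow_succ, ← smul_mul_assoc, ih, sub_mul, smul_mul_assoc, smul_mul_assoc, hM, one_mul]
    push_cast
    rw [eq_sub_of_add_eq h]
    module

/-- The half-angle form of `1 - e^{ix}`. -/
lemma neg_two_I_mul_exp_mul_sin_half (x : ℂ) :
    -2 * I * Complex.exp (I * x / 2) * Complex.sin (x / 2) = 1 - Complex.exp (I * x / 2) ^ 2 := by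
  have h : Complex.exp (I * x / 2) * Complex.exp (-(I * x / 2)) = 1 := by
    rw [← Complex.exp_add]; simp
  rw [Complex.sin, show -(x / 2) * I = -(I * x / 2) by ring, show x / 2 * I = I * x / 2 by ring]
  linear_combination (Complex.exp (I * x / 2) ^ 2
    - Complex.exp (I * x / 2) * Complex.exp (-(I * x / 2))) * Complex.I_sq + h

/-- Underlying Theorem 2 of the paper: at a root `Λ = cos(kπ/n)` of the Chebyshev
polynomial `U_{n−1}`, the matrix `(AB)ⁿ` is scalar, equal to `(−1)^k·e^{in(α+β)/2}·I`. -/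
theorem stmt_13 (lam α β : ℝ) (n k : ℕ) (hn : 2 ≤ n) (hk₁ : 1 ≤ k) (hk₂ : k ≤ n - 1)
    (A B : Matrix (Fin 2) (Fin 2) ℂ)
    (hA : A = !![1, 0;
                 -2 * I * Complex.exp (I * α / 2) * lam * Real.sin (α / 2), Complex.exp (I * α)])
    (hB : B = !![Complex.exp (I * β),
                 -2 * I * Complex.exp (I * β / 2) * lam * Real.sin (β / 2);
                 0, 1])
    (hΛ : (1 - lam ^ 2) * Real.cos ((α - β) / 2) + lam ^ 2 * Real.cos ((α + β) / 2) =
        Real.cos (k * Real.pi / n)) :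
    (A * B) ^ n =
      ((-1 : ℂ) ^ k * Complex.exp (I * n * (α + β) / 2)) • (1 : Matrix (Fin 2) (Fin 2) ℂ) := by
  have hΛ' : (1 - (lam : ℂ) ^ 2) * Complex.cos (α / 2 - β / 2)
      + (lam : ℂ) ^ 2 * Complex.cos (α / 2 + β / 2) = Complex.cos (k * Real.pi / n) := by
    rw [← sub_div, ← add_div]
    exact_mod_cast congrArg (fun x : ℝ => (x : ℂ)) hΛ
  set θ : ℂ := k * Real.pi / n with hθ
  have hsin : Complex.sin θ ≠ 0 := by
    have hn0 : (0 : ℝ) < n := by exact_mod_cast (by omega : 0 < n)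
    have hk0 : (0 : ℝ) < k := by exact_mod_cast hk₁
    have hkn : (k : ℝ) < n := by exact_mod_cast (by omega : k < n)
    have h : 0 < Real.sin (k * Real.pi / n) := by
      apply Real.sin_pos_of_pos_of_lt_pi (by have := Real.pi_pos; positivity)
      rw [div_lt_iff₀ hn0, mul_comm]
      exact mul_lt_mul_of_pos_left hkn Real.pi_pos
    rw [hθ]
    exact_mod_cast h.ne'
  have hp := neg_two_I_mul_exp_mul_sin_half α
  have hq := neg_two_I_mul_exp_mul_sin_half β
  have hp2 : Complex.exp (I * α) = Complex.exp (I * α / 2) ^ 2 := by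
    rw [← Complex.exp_nat_mul]; congr 1; push_cast; ring
  have hq2 : Complex.exp (I * β) = Complex.exp (I * β / 2) ^ 2 := by
    rw [← Complex.exp_nat_mul]; congr 1; push_cast; ring
  have hcos (x : ℂ) : Complex.exp (I * x / 2) * Complex.cos (x / 2) * 2
      = 1 + Complex.exp (I * x / 2) ^ 2 := by
    have h : Complex.exp (I * x / 2) * Complex.exp (-(I * x / 2)) = 1 := by
      rw [← Complex.exp_add]; simp
    rw [Complex.cos, show -(x / 2) * I = -(I * x / 2) by ring,
      show x / 2 * I = I * x / 2 by ring]
    linear_combination h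
  have hcp := hcos α
  have hcq := hcos β
  have hc : Complex.exp (I * n * (α + β) / 2)
      = (Complex.exp (I * α / 2) * Complex.exp (I * β / 2)) ^ n := by
    rw [← Complex.exp_add, ← Complex.exp_nat_mul]; congr 1; ring
  have ha : -2 * I * Complex.exp (I * α / 2) * lam * Real.sin (α / 2)
      = lam * (1 - Complex.exp (I * α / 2) ^ 2) := by
    push_cast; linear_combination (lam : ℂ) * hp
  have hb : -2 * I * Complex.exp (I * β / 2) * lam * Real.sin (β / 2)
      = lam * (1 - Complex.exp (I * β / 2) ^ 2) := by
    push_cast; linear_combination (lam : ℂ) * hq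
  rw [ha, hp2] at hA
  rw [hb, hq2] at hB
  rw [hc]
  rw [Complex.cos_sub, Complex.cos_add] at hΛ'
  set p := Complex.exp (I * α / 2)
  set q := Complex.exp (I * β / 2)
  have hss : (p * Complex.sin (α / 2)) * (q * Complex.sin (β / 2)) * (-4)
      = (1 - p ^ 2) * (1 - q ^ 2) := by
    rw [← hp, ← hq]
    linear_combination (-4 * p * q * Complex.sin (α / 2) * Complex.sin (β / 2)) * Complex.I_sq
  have hcc : (p * Complex.cos (α / 2)) * (q * Complex.cos (β / 2)) * 4
      = (1 + p ^ 2) * (1 + q ^ 2) := by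
    rw [← hcp, ← hcq]; ring
  have htr : 2 * (p * q) * Complex.cos θ
      = p ^ 2 + q ^ 2 + (lam : ℂ) ^ 2 * ((1 - p ^ 2) * (1 - q ^ 2)) := by
    rw [← hΛ']
    linear_combination (1 / 2) * hcc + (lam ^ 2 - 1 / 2) * hss
  have hM : A * B * (A * B) = (2 * (p * q) * Complex.cos θ) • (A * B)
      - ((p * q) ^ 2) • (1 : Matrix (Fin 2) (Fin 2) ℂ) := by
    rw [htr, hA, hB]
    ext i j
    fin_cases i <;> fin_cases j <;> simp [Matrix.mul_apply, Fin.sum_univ_two] <;> ring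
  obtain ⟨m, rfl⟩ : ∃ m, n = m + 1 := ⟨n - 1, by omega⟩
  have hpow := sin_smul_pow_succ (A * B) (p * q) θ hM m
  have hnθ : ((m : ℂ) + 1) * θ = k * Real.pi := by
    have : (m : ℂ) + 1 ≠ 0 := by exact_mod_cast m.succ_ne_zero
    rw [hθ]; push_cast; field_simp
  have hmθ : Complex.sin (m * θ) = -((-1) ^ k * Complex.sin θ) := by
    rw [show (m : ℂ) * θ = k * Real.pi - θ by rw [← hnθ]; ring, Complex.sin_sub,
      Complex.sin_nat_mul_pi]
    have : Complex.cos (k * Real.pi) = (-1) ^ k := by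
      exact_mod_cast congrArg (fun x : ℝ => (x : ℂ)) (Real.cos_nat_mul_pi k)
    rw [this]; ring
  rw [hnθ, Complex.sin_nat_mul_pi, hmθ] at hpow
  apply smul_right_injective _ hsin
  simp only
  rw [hpow]
  module
end
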